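/- Every graph G on n vertices with independence number at most 2 contains an immersion of the complete graph K_{2⌊n/5⌋}. -/

import Mathlib

/-- Every three distinct vertices span at least one edge, i.e. the
independence number of `G` is at most `2`. -/
def IndepNumAtMostTwo {V : Type*} (G : SimpleGraph V) : Prop :=
  ∀ a b c : V, a ≠ b → a ≠ c → b ≠ c → G.Adj a b ∨ G.Adj a c ∨ G.Adj b c
/-- `G` contains an immersion of the complete graph whose branch vertices are
exactly the elements of `B`: a family of pairwise edge-disjoint paths in `G`
joining every pair of distinct vertices of `B`. -/
def HasCliqueImmersionOn {V : Type*} (G : SimpleGraph V) (B : Finset V) : Prop :=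
  ∃ P : (u : V) → (v : V) → u ∈ B → v ∈ B → u ≠ v → G.Walk u v,
    (∀ u v hu hv h, (P u v hu hv h).IsPath) ∧
    (∀ u v u' v' hu hv h hu' hv' h', s(u, v) ≠ s(u', v') →
      ∀ e ∈ (P u v hu hv h).edges, e ∉ (P u' v' hu' hv' h').edges)

/-- `G` contains an immersion of the complete graph `K_t`. -/
def HasCliqueImmersion {V : Type*} (G : SimpleGraph V) (t : ℕ) : Prop :=
  ∃ B : Finset V, B.card = t ∧ HasCliqueImmersionOn G B

/-- The subgraph of `G[S]` formed by the edges labelled `p` by `lbl`. -/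
def labelLayer {V : Type*} (G : SimpleGraph V) (S : Finset V) (lbl : V → V → Sym2 V)
    (p : Sym2 V) : SimpleGraph V where
  Adj u v := G.Adj u v ∧ u ∈ S ∧ v ∈ S ∧ lbl u v = p ∧ lbl v u = p
  symm := ⟨fun _ _ ⟨h, hu, hv, h₁, h₂⟩ => ⟨h.symm, hv, hu, h₂, h₁⟩⟩
  loopless := ⟨fun _ h => h.1.ne rfl⟩

/-- The edges of `G[S]` can be labelled by pairs of vertices so that any two distinct vertices
`u, v` of `B` are joined by edges labelled `s(u, v)`. -/
def HasLabelledImmersion {V : Type*} (G : SimpleGraph V) (S B : Finset V) : Prop :=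
  ∃ lbl : V → V → Sym2 V, ∀ u ∈ B, ∀ v ∈ B, u ≠ v →
    (labelLayer G S lbl s(u, v)).Reachable u v

/-- The subgraph of `G` induced on `S` has independence number at most `2`. -/
def IndepNumAtMostTwoOn {V : Type*} (G : SimpleGraph V) (S : Finset V) : Prop :=
  ∀ a ∈ S, ∀ b ∈ S, ∀ c ∈ S, a ≠ b → a ≠ c → b ≠ c → G.Adj a b ∨ G.Adj a c ∨ G.Adj b c

/-- `a₀, …, a₄` induce a five-cycle in the complement of `G`, in this cyclic order. -/
structure IsCoPentagon {V : Type*} (G : SimpleGraph V) (a₀ a₁ a₂ a₃ a₄ : V) : Prop where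
  ne₀₁ : a₀ ≠ a₁
  ne₁₂ : a₁ ≠ a₂
  ne₂₃ : a₂ ≠ a₃
  ne₃₄ : a₃ ≠ a₄
  ne₄₀ : a₄ ≠ a₀
  not_adj₀₁ : ¬ G.Adj a₀ a₁
  not_adj₁₂ : ¬ G.Adj a₁ a₂
  not_adj₂₃ : ¬ G.Adj a₂ a₃
  not_adj₃₄ : ¬ G.Adj a₃ a₄
  not_adj₄₀ : ¬ G.Adj a₄ a₀
  adj₀₂ : G.Adj a₀ a₂
  adj₁₃ : G.Adj a₁ a₃
  adj₂₄ : G.Adj a₂ a₄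
  adj₃₀ : G.Adj a₃ a₀
  adj₄₁ : G.Adj a₄ a₁

section

variable {V : Type*} {G : SimpleGraph V}

theorem IsCoPentagon.rotate {a₀ a₁ a₂ a₃ a₄ : V} (h : IsCoPentagon G a₀ a₁ a₂ a₃ a₄) :
    IsCoPentagon G a₁ a₂ a₃ a₄ a₀ :=
  ⟨h.ne₁₂, h.ne₂₃, h.ne₃₄, h.ne₄₀, h.ne₀₁, h.not_adj₁₂, h.not_adj₂₃, h.not_adj₃₄, h.not_adj₄₀,
    h.not_adj₀₁, h.adj₁₃, h.adj₂₄, h.adj₃₀, h.adj₄₁, h.adj₀₂⟩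

theorem IndepNumAtMostTwoOn.adj_or_adj {S T : Finset V} (h : IndepNumAtMostTwoOn G S)
    (hTS : T ⊆ S) {x y : V} (hx : x ∈ S) (hy : y ∈ S) (hxT : x ∉ T) (hyT : y ∉ T) (hxy : x ≠ y)
    (hadj : ¬ G.Adj x y) (z : V) (hz : z ∈ T) : G.Adj z x ∨ G.Adj z y := by
  have := h z (hTS hz) x hx y hy (ne_of_mem_of_not_mem hz hxT) (ne_of_mem_of_not_mem hz hyT) hxy
  tauto

theorem labelLayer_mono {G' : SimpleGraph V} (hG : G' ≤ G) {S : Finset V}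
    {lbl : V → V → Sym2 V} {p : Sym2 V} : labelLayer G' S lbl p ≤ labelLayer G S lbl p :=
  fun _ _ hab => ⟨hG hab.1, hab.2⟩

theorem HasLabelledImmersion.mono {G' : SimpleGraph V} {S B : Finset V} (hG : G' ≤ G)
    (h : HasLabelledImmersion G' S B) : HasLabelledImmersion G S B := by
  obtain ⟨lbl, h⟩ := h
  exact ⟨lbl, fun u hu v hv huv => (h u hu v hv huv).mono (labelLayer_mono hG)⟩

theorem HasLabelledImmersion.hasCliqueImmersionOn {S B : Finset V}
    (h : HasLabelledImmersion G S B) : HasCliqueImmersionOn G B := by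
  obtain ⟨lbl, h⟩ := h
  have hle (p) : labelLayer G S lbl p ≤ G := fun _ _ hab => hab.1
  choose Q hQ using fun u hu v hv huv => (h u hu v hv huv).exists_isPath
  refine ⟨fun u v hu hv huv => (Q u hu v hv huv).mapLe (hle _),
    fun u v hu hv huv => (hQ u hu v hv huv).mapLe _, ?_⟩
  intro u v u' v' hu hv huv hu' hv' huv' hne e he he'
  rw [SimpleGraph.Walk.edges_mapLe_eq_edges] at he he'
  have h₁ := SimpleGraph.Walk.edges_subset_edgeSet _ he
  have h₂ := SimpleGraph.Walk.edges_subset_edgeSet _ he'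
  induction e with
  | _ x y => exact hne (h₁.2.2.2.1.symm.trans h₂.2.2.2.1)

theorem SimpleGraph.IsClique.hasLabelledImmersion {S B : Finset V} (hB : B ⊆ S)
    (h : G.IsClique B) : HasLabelledImmersion G S B :=
  ⟨fun u v => s(u, v), fun _ hu _ hv huv =>
    SimpleGraph.Adj.reachable ⟨h hu hv huv, hB hu, hB hv, rfl, Sym2.eq_swap⟩⟩

open Classical in
/-- Adding two consecutive vertices of a co-pentagon to the branch vertices. Each missing edge
`a₀ b` or `a₁ b` is replaced by a path of length three whose second vertex `c` is labelled by
the pair to be joined. -/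
theorem IsCoPentagon.hasLabelledImmersion_insert {S T B O : Finset V} {a₀ a₁ a₂ a₃ a₄ : V}
    (hP : IsCoPentagon G a₀ a₁ a₂ a₃ a₄) (hα : IndepNumAtMostTwoOn G S)
    (hTS : T ⊆ S) (hBT : B ⊆ T) (hOT : O ⊆ T) (hOB : Disjoint O B)
    (hS₀ : a₀ ∈ S) (hS₁ : a₁ ∈ S) (hS₂ : a₂ ∈ S) (hS₃ : a₃ ∈ S) (hS₄ : a₄ ∈ S)
    (hT₀ : a₀ ∉ T) (hT₁ : a₁ ∉ T) (hT₂ : a₂ ∉ T) (hT₃ : a₃ ∉ T) (hT₄ : a₄ ∉ T)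
    (hO : ∀ c ∈ O, G.Adj c a₂ ∨ G.Adj c a₄) (g : V → Sym2 V)
    (hg₀ : ∀ b ∈ B, ¬ G.Adj b a₀ → ∃ c ∈ O, G.Adj c a₀ ∧ g c = s(a₀, b))
    (hg₁ : ∀ b ∈ B, ¬ G.Adj b a₁ → ∃ c ∈ O, G.Adj c a₁ ∧ g c = s(a₁, b))
    (hB : HasLabelledImmersion G T B) :
    HasLabelledImmersion G S (insert a₀ (insert a₁ B)) := by
  obtain ⟨lbl, hlbl⟩ := hB
  let f : V → V → Sym2 V := fun q z =>
    if z ∈ B then (if q = a₀ ∨ q = a₁ then s(q, z)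
      else if G.Adj z a₀ then s(a₁, z) else s(a₀, z)) else g z
  let lbl' : V → V → Sym2 V := fun u v =>
    if u ∈ T then (if v ∈ T then lbl u v else f v u)
      else if v ∈ T then f u v else s(a₀, a₁)
  have hedge (q z) (hq : q ∈ S) (hqT : q ∉ T) (hz : z ∈ T) (h : G.Adj q z) :
      (labelLayer G S lbl' (f q z)).Adj q z :=
    ⟨h, hq, hTS hz, by simp [lbl', hqT, hz], by simp [lbl', hqT, hz]⟩
  have hin (q r) (hq : q ∈ S) (hqT : q ∉ T) (hr : r ∈ S) (hrT : r ∉ T) (h : G.Adj q r) :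
      (labelLayer G S lbl' s(a₀, a₁)).Adj q r :=
    ⟨h, hq, hr, by simp [lbl', hqT, hrT], by simp [lbl', hqT, hrT]⟩
  have hthree (x b c w) (hx : x ∈ S) (hxT : x ∉ T) (hw : w ∈ S) (hwT : w ∉ T) (hb : b ∈ B)
      (hc : c ∈ O) (hcx : G.Adj c x) (hcw : G.Adj c w) (hbw : G.Adj b w) (hgc : g c = s(x, b))
      (hfw : f w b = s(x, b)) : (labelLayer G S lbl' s(x, b)).Reachable x b := by
    have hcB := Finset.disjoint_left.1 hOB hc
    have hfc (q) : f q c = s(x, b) := by simp [f, hcB, hgc]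
    have h₁ := hedge x c hx hxT (hOT hc) hcx.symm
    have h₂ := hedge w c hw hwT (hOT hc) hcw.symm
    have h₃ := hedge w b hw hwT (hBT hb) hbw.symm
    rw [hfc] at h₁ h₂
    rw [hfw] at h₃
    exact h₁.reachable.trans (h₂.symm.reachable.trans h₃.reachable)
  have hα₀₁ (z) (hz : z ∈ T) : G.Adj z a₀ ∨ G.Adj z a₁ :=
    hα.adj_or_adj hTS hS₀ hS₁ hT₀ hT₁ hP.ne₀₁ hP.not_adj₀₁ z hz
  have hα₁₂ (z) (hz : z ∈ T) : G.Adj z a₁ ∨ G.Adj z a₂ :=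
    hα.adj_or_adj hTS hS₁ hS₂ hT₁ hT₂ hP.ne₁₂ hP.not_adj₁₂ z hz
  have hα₂₃ (z) (hz : z ∈ T) : G.Adj z a₂ ∨ G.Adj z a₃ :=
    hα.adj_or_adj hTS hS₂ hS₃ hT₂ hT₃ hP.ne₂₃ hP.not_adj₂₃ z hz
  have hα₃₄ (z) (hz : z ∈ T) : G.Adj z a₃ ∨ G.Adj z a₄ :=
    hα.adj_or_adj hTS hS₃ hS₄ hT₃ hT₄ hP.ne₃₄ hP.not_adj₃₄ z hz
  have hα₄₀ (z) (hz : z ∈ T) : G.Adj z a₄ ∨ G.Adj z a₀ :=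
    hα.adj_or_adj hTS hS₄ hS₀ hT₄ hT₀ hP.ne₄₀ hP.not_adj₄₀ z hz
  have hw₂ : a₂ ≠ a₀ ∧ a₂ ≠ a₁ := ⟨hP.adj₀₂.ne', hP.ne₁₂.symm⟩
  have hw₃ : a₃ ≠ a₀ ∧ a₃ ≠ a₁ := ⟨hP.adj₃₀.ne, hP.adj₁₃.ne'⟩
  have hw₄ : a₄ ≠ a₀ ∧ a₄ ≠ a₁ := ⟨hP.ne₄₀, hP.adj₄₁.ne⟩
  have hr₀₁ : (labelLayer G S lbl' s(a₀, a₁)).Reachable a₀ a₁ :=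
    (hin _ _ hS₀ hT₀ hS₃ hT₃ hP.adj₃₀.symm).reachable.trans
      (hin _ _ hS₃ hT₃ hS₁ hT₁ hP.adj₁₃.symm).reachable
  have hr₀ (b) (hb : b ∈ B) : (labelLayer G S lbl' s(a₀, b)).Reachable a₀ b := by
    by_cases hba : G.Adj b a₀
    · have := hedge a₀ b hS₀ hT₀ (hBT hb) hba.symm
      rw [show f a₀ b = s(a₀, b) by simp [f, hb]] at this
      exact this.reachable
    · obtain ⟨c, hc, hca, hgc⟩ := hg₀ b hb hba
      have hf (w) (hw : w ≠ a₀ ∧ w ≠ a₁) : f w b = s(a₀, b) := by simp [f, hb, hw, hba]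
      have key (w) (hw : w ∈ S) (hwT : w ∉ T) (hne : w ≠ a₀ ∧ w ≠ a₁) (hcw : G.Adj c w)
          (hbw : G.Adj b w) :=
        hthree a₀ b c w hS₀ hT₀ hw hwT hb hc hca hcw hbw hgc (hf w hne)
      grind
  have hr₁ (b) (hb : b ∈ B) : (labelLayer G S lbl' s(a₁, b)).Reachable a₁ b := by
    by_cases hba : G.Adj b a₁
    · have := hedge a₁ b hS₁ hT₁ (hBT hb) hba.symm
      rw [show f a₁ b = s(a₁, b) by simp [f, hb]] at this
      exact this.reachable
    · obtain ⟨c, hc, hca, hgc⟩ := hg₁ b hb hba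
      have hba₀ : G.Adj b a₀ := (hα₀₁ b (hBT hb)).resolve_right hba
      have hf (w) (hw : w ≠ a₀ ∧ w ≠ a₁) : f w b = s(a₁, b) := by simp [f, hb, hw, hba₀]
      have key (w) (hw : w ∈ S) (hwT : w ∉ T) (hne : w ≠ a₀ ∧ w ≠ a₁) (hcw : G.Adj c w)
          (hbw : G.Adj b w) :=
        hthree a₁ b c w hS₁ hT₁ hw hwT hb hc hca hcw hbw hgc (hf w hne)
      grind
  refine ⟨lbl', fun u hu v hv huv => ?_⟩
  have hold (hu : u ∈ B) (hv : v ∈ B) : (labelLayer G S lbl' s(u, v)).Reachable u v := by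
    have hle : labelLayer G T lbl s(u, v) ≤ labelLayer G S lbl' s(u, v) :=
      fun a b ⟨hab, ha, hb, h₁, h₂⟩ => ⟨hab, hTS ha, hTS hb, by simpa [lbl', ha, hb], by simpa [lbl', ha, hb]⟩
    exact (hlbl u hu v hv huv).mono hle
  simp only [Finset.mem_insert] at hu hv
  rcases hu with rfl | rfl | hu <;> rcases hv with rfl | rfl | hv
  · exact absurd rfl huv
  · exact hr₀₁
  · exact hr₀ v hv
  · rw [Sym2.eq_swap]; exact hr₀₁.symm
  · exact absurd rfl huv
  · exact hr₁ v hv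
  · rw [Sym2.eq_swap]; exact (hr₀ u hu).symm
  · rw [Sym2.eq_swap]; exact (hr₁ u hu).symm
  · exact hold hu hv

open Classical in
theorem Finset.exists_forall_exists_eq_of_card_le {A X : Finset V} (h : A.card ≤ X.card) :
    ∃ φ : V → V, ∀ b ∈ A, ∃ c ∈ X, φ c = b := by
  obtain ⟨X', hX, hc⟩ := Finset.exists_subset_card_eq h
  let e := Finset.equivOfCardEq hc
  exact ⟨fun c => if hc : c ∈ X' then e ⟨c, hc⟩ else c, fun b hb =>
    ⟨e.symm ⟨b, hb⟩, hX (e.symm ⟨b, hb⟩).2, by simp⟩⟩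

open Classical in
theorem Finset.exists_disjoint_subsets_card_eq {X Y : Finset V} {m n : ℕ} (hm : m ≤ X.card)
    (hn : n ≤ Y.card) (hmn : m + n ≤ (X ∪ Y).card) :
    ∃ X' ⊆ X, ∃ Y' ⊆ Y, Disjoint X' Y' ∧ X'.card = m ∧ Y'.card = n := by
  obtain ⟨X', hX', hXm, hY⟩ : ∃ X' ⊆ X, X'.card = m ∧ n ≤ (Y \ X').card := by
    rcases le_total m (X \ Y).card with h | h
    · obtain ⟨X', hX', hc⟩ := Finset.exists_subset_card_eq h
      refine ⟨X', hX'.trans Finset.sdiff_subset, hc, ?_⟩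
      rwa [Finset.sdiff_eq_self_of_disjoint
        (Finset.disjoint_of_subset_right hX' Finset.disjoint_sdiff)]
    · obtain ⟨X', h₁, h₂, hc⟩ :=
        Finset.exists_subsuperset_card_eq (Finset.sdiff_subset (s := X) (t := Y)) h hm
      refine ⟨X', h₂, hc, ?_⟩
      have : (X ∪ Y) \ X' ⊆ Y \ X' := by
        intro z hz
        have := @h₁ z
        grind
      have := Finset.card_le_card this
      have := Finset.le_card_sdiff X' (X ∪ Y)
      omega
  obtain ⟨Y', hY', hc⟩ := Finset.exists_subset_card_eq hY
  exact ⟨X', hX', Y', hY'.trans Finset.sdiff_subset,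
    Finset.disjoint_of_subset_right hY' Finset.disjoint_sdiff, hXm, hc⟩

open Classical in
theorem Finset.exists_pair_labelling {A₀ A₁ X Y : Finset V} (a₀ a₁ : V) (h₀ : A₀.card ≤ X.card)
    (h₁ : A₁.card ≤ Y.card) (h : A₀.card + A₁.card ≤ (X ∪ Y).card) :
    ∃ g : V → Sym2 V, (∀ b ∈ A₀, ∃ c ∈ X, g c = s(a₀, b)) ∧
      (∀ b ∈ A₁, ∃ c ∈ Y, g c = s(a₁, b)) := by
  obtain ⟨X', hX, Y', hY, hd, hc₀, hc₁⟩ := Finset.exists_disjoint_subsets_card_eq h₀ h₁ h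
  obtain ⟨φ, hφ⟩ := Finset.exists_forall_exists_eq_of_card_le hc₀.ge
  obtain ⟨ψ, hψ⟩ := Finset.exists_forall_exists_eq_of_card_le hc₁.ge
  refine ⟨fun c => if c ∈ X' then s(a₀, φ c) else s(a₁, ψ c), fun b hb => ?_, fun b hb => ?_⟩
  · obtain ⟨c, hc, rfl⟩ := hφ b hb
    exact ⟨c, hX hc, by simp [hc]⟩
  · obtain ⟨c, hc, rfl⟩ := hψ b hb
    exact ⟨c, hY hc, by simp [Finset.disjoint_right.1 hd hc]⟩

/-- In an edge-minimal graph of independence number at most two, the ends of every edge have a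
common non-neighbour. -/
theorem IndepNumAtMostTwoOn.exists_common_nonneighbor {S : Finset V}
    (h : Minimal (fun H => IndepNumAtMostTwoOn H S) G) {a b : V} (hab : G.Adj a b) :
    ∃ c ∈ S, c ≠ a ∧ c ≠ b ∧ ¬ G.Adj a c ∧ ¬ G.Adj b c := by
  by_contra! hcon
  have hle := h.le_of_le (y := G.deleteEdges {s(a, b)}) ?_ (G.deleteEdges_le _)
  · simpa using hle hab
  · intro x hx y hy z hz hxy hxz hyz
    have := h.prop x hx y hy z hz hxy hxz hyz
    have := hcon x hx
    have := hcon y hy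
    have := hcon z hz
    simp only [SimpleGraph.deleteEdges_adj, Set.mem_singleton_iff, Sym2.eq_iff]
    grind [SimpleGraph.adj_comm]

open Classical in
theorem IndepNumAtMostTwoOn.isClique_filter_not_adj {S : Finset V}
    (h : IndepNumAtMostTwoOn G S) {x : V} (hx : x ∈ S) :
    G.IsClique (S.filter fun z => z ≠ x ∧ ¬ G.Adj x z : Finset V) := by
  intro u hu v hv huv
  simp only [Finset.coe_filter, Set.mem_ofPred_eq] at hu hv
  have := h x hx u hu.1 v hv.1
  grind

open Classical in
/-- An edge-minimal graph of independence number at most two contains a co-pentagon, unless the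
vertices equal or adjacent to some given vertex `x` form a clique. -/
theorem IndepNumAtMostTwoOn.exists_isCoPentagon {S : Finset V}
    (h : Minimal (fun H => IndepNumAtMostTwoOn H S) G) {x : V} (hx : x ∈ S)
    (hcl : ¬ G.IsClique (S.filter fun z => ¬ (z ≠ x ∧ ¬ G.Adj x z) : Finset V)) :
    ∃ a₀ ∈ S, ∃ a₁ ∈ S, ∃ a₂ ∈ S, ∃ a₃ ∈ S, ∃ a₄ ∈ S, IsCoPentagon G a₀ a₁ a₂ a₃ a₄ := by
  rw [SimpleGraph.isClique_iff, Set.Pairwise] at hcl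
  push Not at hcl
  obtain ⟨u, hu, v, hv, huv, huv'⟩ := hcl
  simp only [Finset.coe_filter, Set.mem_ofPred_eq] at hu hv
  have hxu : G.Adj x u := by grind [SimpleGraph.adj_comm]
  have hxv : G.Adj x v := by grind [SimpleGraph.adj_comm]
  obtain ⟨u', hu', hne₁, hne₂, hn₁, hn₂⟩ := exists_common_nonneighbor h hxu
  obtain ⟨v', hv', hne₃, hne₄, hn₃, hn₄⟩ := exists_common_nonneighbor h hxv
  have hα := h.prop
  have h₁ := hα u hu.1 v hv.1 u' hu'
  have h₂ := hα u hu.1 v hv.1 v' hv'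
  have h₃ := hα x hx u' hu' v' hv'
  refine ⟨x, hx, u', hu', u, hu.1, v, hv.1, v', hv', ?_⟩
  constructor <;> grind [SimpleGraph.adj_comm]

open Classical in
/-- If every vertex of `S` has few non-neighbours and `a₂, a₄` have few common non-neighbours
outside the branch set, then `a₀, a₁` can be added to the branch set. -/
theorem IsCoPentagon.hasLabelledImmersion_insert_of_card_le {S T B : Finset V} {k : ℕ}
    {a₀ a₁ a₂ a₃ a₄ : V} (hP : IsCoPentagon G a₀ a₁ a₂ a₃ a₄) (hα : IndepNumAtMostTwoOn G S)
    (hTS : T ⊆ S) (hBT : B ⊆ T)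
    (hS : ∀ z ∈ ({a₀, a₁, a₂, a₃, a₄} : Finset V), z ∈ S ∧ z ∉ T)
    (hT : T.card = 5 * k) (hBk : B.card = 2 * k)
    (hnon : ∀ x ∈ S, (S.filter fun z => z ≠ x ∧ ¬ G.Adj x z).card < 2 * (k + 1))
    (hC : ((T \ B).filter fun c => ¬ G.Adj c a₂ ∧ ¬ G.Adj c a₄).card ≤ k)
    (hB : HasLabelledImmersion G T B) :
    HasLabelledImmersion G S (insert a₀ (insert a₁ B)) := by
  have hO : (T \ B).card = 3 * k := by
    rw [Finset.card_sdiff_of_subset hBT]; omega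
  obtain ⟨O, hOmem⟩ : ∃ O : Finset V, ∀ c, c ∈ O ↔ c ∈ T \ B ∧ (G.Adj c a₂ ∨ G.Adj c a₄) :=
    ⟨(T \ B).filter fun c => G.Adj c a₂ ∨ G.Adj c a₄, by simp⟩
  have hOcard : 2 * k ≤ O.card := by
    have hle : (T \ B).card ≤
        (((T \ B).filter fun c => ¬ G.Adj c a₂ ∧ ¬ G.Adj c a₄) ∪ O).card := by
      refine Finset.card_le_card fun z hz => ?_
      rw [Finset.mem_union, Finset.mem_filter, hOmem]
      tauto
    have := hle.trans (Finset.card_union_le _ _)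
    omega
  have hcount (x y) (hx : x ∈ S) (hxT : x ∉ T) (hy : y ∈ S) (hyT : y ∉ T) (hxy : x ≠ y)
      (hadj : ¬ G.Adj x y) :
      (B.filter fun b => ¬ G.Adj b x).card ≤ (O.filter fun c => G.Adj c x).card := by
    have hN : (insert y (T.filter fun z => ¬ G.Adj z x)).card < 2 * (k + 1) := by
      refine (Finset.card_le_card ?_).trans_lt (hnon x hx)
      intro z hz
      grind [SimpleGraph.adj_comm]
    rw [Finset.card_insert_of_notMem (by simp [hyT])] at hN
    have hle : ((B.filter fun b => ¬ G.Adj b x) ∪ (O.filter fun c => ¬ G.Adj c x)).card ≤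
        (T.filter fun z => ¬ G.Adj z x).card := Finset.card_le_card (by grind)
    rw [Finset.card_union_of_disjoint (by rw [Finset.disjoint_left]; grind)] at hle
    have := Finset.card_filter_add_card_filter_not (s := O) (fun c => G.Adj c x)
    omega
  simp only [Finset.mem_insert, Finset.mem_singleton, forall_eq_or_imp, forall_eq] at hS
  obtain ⟨⟨hS₀, hT₀⟩, ⟨hS₁, hT₁⟩, ⟨hS₂, hT₂⟩, ⟨hS₃, hT₃⟩, hS₄, hT₄⟩ := hS
  have hadj (z) (hz : z ∈ T) : G.Adj z a₀ ∨ G.Adj z a₁ :=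
    hα.adj_or_adj hTS hS₀ hS₁ hT₀ hT₁ hP.ne₀₁ hP.not_adj₀₁ z hz
  have hsum : (B.filter fun b => ¬ G.Adj b a₀).card + (B.filter fun b => ¬ G.Adj b a₁).card ≤
      ((O.filter fun c => G.Adj c a₀) ∪ (O.filter fun c => G.Adj c a₁)).card := by
    have hu : (O.filter fun c => G.Adj c a₀) ∪ (O.filter fun c => G.Adj c a₁) = O := by
      ext z
      grind
    rw [hu, ← Finset.card_union_of_disjoint (by rw [Finset.disjoint_left]; grind)]
    have : (B.filter fun b => ¬ G.Adj b a₀) ∪ (B.filter fun b => ¬ G.Adj b a₁) ⊆ B := by grind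
    have := Finset.card_le_card this
    omega
  obtain ⟨g, hg₀, hg₁⟩ := Finset.exists_pair_labelling a₀ a₁
    (hcount a₀ a₁ hS₀ hT₀ hS₁ hT₁ hP.ne₀₁ hP.not_adj₀₁)
    (hcount a₁ a₀ hS₁ hT₁ hS₀ hT₀ hP.ne₀₁.symm fun h => hP.not_adj₀₁ h.symm) hsum
  refine hP.hasLabelledImmersion_insert (O := O) hα hTS hBT (by grind)
    (by rw [Finset.disjoint_left]; grind) hS₀ hS₁ hS₂ hS₃ hS₄ hT₀ hT₁ hT₂ hT₃ hT₄ (by grind) g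
    (fun b hb hba => ?_) (fun b hb hba => ?_) hB
  · obtain ⟨c, hc, hgc⟩ := hg₀ b (by grind)
    exact ⟨c, by grind, by grind, hgc⟩
  · obtain ⟨c, hc, hgc⟩ := hg₁ b (by grind)
    exact ⟨c, by grind, by grind, hgc⟩

open Classical in
/-- Three chords of the co-pentagon have disjoint sets of common non-neighbours, one of which
is therefore small. -/
theorem IsCoPentagon.card_common_nonneighbors_le {S O : Finset V} {k : ℕ} {a₀ a₁ a₂ a₃ a₄ : V}
    (hP : IsCoPentagon G a₀ a₁ a₂ a₃ a₄) (hα : IndepNumAtMostTwoOn G S) (hOS : O ⊆ S)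
    (hS : ∀ z ∈ ({a₀, a₁, a₂, a₃, a₄} : Finset V), z ∈ S ∧ z ∉ O) (hO : O.card ≤ 3 * k) :
    (O.filter fun c => ¬ G.Adj c a₂ ∧ ¬ G.Adj c a₄).card ≤ k ∨
    (O.filter fun c => ¬ G.Adj c a₃ ∧ ¬ G.Adj c a₀).card ≤ k ∨
    (O.filter fun c => ¬ G.Adj c a₄ ∧ ¬ G.Adj c a₁).card ≤ k := by
  simp only [Finset.mem_insert, Finset.mem_singleton, forall_eq_or_imp, forall_eq] at hS
  obtain ⟨⟨hS₀, hO₀⟩, ⟨hS₁, hO₁⟩, ⟨hS₂, hO₂⟩, ⟨hS₃, hO₃⟩, hS₄, hO₄⟩ := hS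
  have h₁₂ (z) (hz : z ∈ O) : G.Adj z a₁ ∨ G.Adj z a₂ :=
    hα.adj_or_adj hOS hS₁ hS₂ hO₁ hO₂ hP.ne₁₂ hP.not_adj₁₂ z hz
  have h₂₃ (z) (hz : z ∈ O) : G.Adj z a₂ ∨ G.Adj z a₃ :=
    hα.adj_or_adj hOS hS₂ hS₃ hO₂ hO₃ hP.ne₂₃ hP.not_adj₂₃ z hz
  have h₃₄ (z) (hz : z ∈ O) : G.Adj z a₃ ∨ G.Adj z a₄ :=
    hα.adj_or_adj hOS hS₃ hS₄ hO₃ hO₄ hP.ne₃₄ hP.not_adj₃₄ z hz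
  by_contra! hc
  set X := O.filter fun c => ¬ G.Adj c a₂ ∧ ¬ G.Adj c a₄
  set Y := O.filter fun c => ¬ G.Adj c a₃ ∧ ¬ G.Adj c a₀
  set Z := O.filter fun c => ¬ G.Adj c a₄ ∧ ¬ G.Adj c a₁
  have hXY : Disjoint X Y := by rw [Finset.disjoint_left]; grind
  have hXYZ : Disjoint (X ∪ Y) Z := by rw [Finset.disjoint_left]; grind
  have hle : (X ∪ Y ∪ Z).card ≤ O.card := Finset.card_le_card (by grind)
  rw [Finset.card_union_of_disjoint hXYZ, Finset.card_union_of_disjoint hXY] at hle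
  omega

open Classical in
theorem IndepNumAtMostTwoOn.exists_hasLabelledImmersion [Finite V] (k : ℕ)
    (G : SimpleGraph V) (S : Finset V) (hS : S.card = 5 * k) (hα : IndepNumAtMostTwoOn G S) :
    ∃ B ⊆ S, B.card = 2 * k ∧ HasLabelledImmersion G S B := by
  induction k generalizing G S with
  | zero => exact ⟨∅, by simp, by simp, fun u v => s(u, v), by simp⟩
  | succ k ih =>
    obtain ⟨G', hG', hmin⟩ :=
      exists_minimal_le_of_wellFoundedLT (fun H => IndepNumAtMostTwoOn H S) G hα
    suffices ∃ B ⊆ S, B.card = 2 * (k + 1) ∧ HasLabelledImmersion G' S B by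
      obtain ⟨B, hBS, hB, hI⟩ := this
      exact ⟨B, hBS, hB, hI.mono hG'⟩
    clear hα
    have hα := hmin.prop
    by_cases hclique : ∃ A ⊆ S, 2 * (k + 1) ≤ A.card ∧ G'.IsClique A
    · obtain ⟨A, hAS, hA, hcl⟩ := hclique
      obtain ⟨B, hBA, hB⟩ := Finset.exists_subset_card_eq hA
      exact ⟨B, hBA.trans hAS, hB,
        (hcl.subset (by simpa using hBA)).hasLabelledImmersion (hBA.trans hAS)⟩
    push Not at hclique
    have hnon (x) (hx : x ∈ S) : (S.filter fun z => z ≠ x ∧ ¬ G'.Adj x z).card < 2 * (k + 1) := by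
      by_contra! hc
      exact hclique _ (Finset.filter_subset _ _) hc (hα.isClique_filter_not_adj hx)
    obtain ⟨x, hx⟩ : S.Nonempty := by rw [← Finset.card_pos]; omega
    obtain ⟨a₀, h₀, a₁, h₁, a₂, h₂, a₃, h₃, a₄, h₄, hP⟩ :=
      IndepNumAtMostTwoOn.exists_isCoPentagon hmin hx <| hclique _ (Finset.filter_subset _ _) <| by
        have := Finset.card_filter_add_card_filter_not (s := S)
          (fun z => z ≠ x ∧ ¬ G'.Adj x z)
        have := hnon x hx
        omega
    set T := S \ {a₀, a₁, a₂, a₃, a₄} with hT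
    have hTS : T ⊆ S := Finset.sdiff_subset
    have hTcard : T.card = 5 * k := by
      have : ({a₀, a₁, a₂, a₃, a₄} : Finset V).card = 5 := by
        have := hP.adj₀₂.ne
        have := hP.adj₁₃.ne
        have := hP.adj₂₄.ne
        have := hP.adj₃₀.ne
        have := hP.adj₄₁.ne
        grind [hP.ne₀₁, hP.ne₁₂, hP.ne₂₃, hP.ne₃₄, hP.ne₄₀]
      rw [hT, Finset.card_sdiff_of_subset (by grind)]
      omega
    obtain ⟨B, hBT, hB, hI⟩ := ih G' T hTcard fun a ha b hb c hc =>
      hα a (hTS ha) b (hTS hb) c (hTS hc)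
    have hmem : ∀ z ∈ ({a₀, a₁, a₂, a₃, a₄} : Finset V), z ∈ S ∧ z ∉ T := by grind
    have hins (x y) (hx : x ∈ S ∧ x ∉ T) (hy : y ∈ S ∧ y ∉ T) (hxy : x ≠ y)
        (h : HasLabelledImmersion G' S (insert x (insert y B))) :
        ∃ B ⊆ S, B.card = 2 * (k + 1) ∧ HasLabelledImmersion G' S B := by
      refine ⟨_, by grind, ?_, h⟩
      rw [Finset.card_insert_of_notMem (by grind), Finset.card_insert_of_notMem (by grind)]
      omega
    have hO : (T \ B).card ≤ 3 * k := by
      rw [Finset.card_sdiff_of_subset hBT]; omega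
    rcases hP.card_common_nonneighbors_le hα (Finset.sdiff_subset.trans hTS) (by grind) hO
      with hC | hC | hC
    · exact hins a₀ a₁ (hmem _ (by simp)) (hmem _ (by simp)) hP.ne₀₁ <|
        hP.hasLabelledImmersion_insert_of_card_le hα hTS hBT hmem hTcard hB hnon hC hI
    · exact hins a₁ a₂ (hmem _ (by simp)) (hmem _ (by simp)) hP.ne₁₂ <|
        hP.rotate.hasLabelledImmersion_insert_of_card_le hα hTS hBT (by grind) hTcard hB hnon hC hI
    · exact hins a₂ a₃ (hmem _ (by simp)) (hmem _ (by simp)) hP.ne₂₃ <|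
        hP.rotate.rotate.hasLabelledImmersion_insert_of_card_le hα hTS hBT (by grind) hTcard hB
          hnon hC hI

end

/-- Gauthier–Le–Wollan: every graph on `n` vertices with independence number at
most 2 contains an immersion of `K_{2⌊n/5⌋}`. -/
theorem immersion_two_fifths {V : Type*} [Fintype V] (G : SimpleGraph V)
    (hα : IndepNumAtMostTwo G) :
    HasCliqueImmersion G (2 * (Fintype.card V / 5)) := by
  obtain ⟨S, -, hS⟩ := Finset.exists_subset_card_eq
    (s := (Finset.univ : Finset V)) (n := 5 * (Fintype.card V / 5))
    (by rw [Finset.card_univ]; omega)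
  obtain ⟨B, -, hB, hI⟩ := IndepNumAtMostTwoOn.exists_hasLabelledImmersion _ G S hS
    fun a _ b _ c _ => hα a b c
  exact ⟨B, hB, hI.hasCliqueImmersionOn⟩
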